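/- No joint distribution exists reproducing the Hardy possibilistic constraints with a nonzero fourth probability: for every probability mass function p on Bool × Bool × Bool × Bool (outcomes (a,b,c,d)), if the probability of the event {c = true ∧ d = true} is 0, the probability of {a = true ∧ d = false} is 0, and the probability of {c = false ∧ b = true} is 0, then the probability of {a = true ∧ b = true} is also 0. In particular, no joint distribution has these three events of probability zero while assigning probability 1/12 to {a = true ∧ b = true}. -/

import Mathlib

open scoped ENNReal

/-- Hardy's paradox for an arbitrary measure: null constraints force the fourth event to be null. -/
theorem hardy_measure_eq_zero (μ : MeasureTheory.Measure (Bool × Bool × Bool × Bool))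
    (hcd : μ {x | x.2.2.1 = true ∧ x.2.2.2 = true} = 0)
    (had : μ {x | x.1 = true ∧ x.2.2.2 = false} = 0)
    (hcb : μ {x | x.2.2.1 = false ∧ x.2.1 = true} = 0) :
    μ {x | x.1 = true ∧ x.2.1 = true} = 0 := by
  refine MeasureTheory.measure_mono_null ?_
    (MeasureTheory.measure_union_null (MeasureTheory.measure_union_null hcd had) hcb)
  rintro ⟨a, b, c, d⟩ ⟨ha, hb⟩
  cases c <;> cases d <;> simp_all

/-- No joint distribution reproduces the Hardy possibilistic constraints with
a nonzero fourth probability.  Outcomes are tuples `(a, b, c, d)` with the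
encodings: `a = true ↔` Alice sees '−', `b = true ↔` Bob sees '−',
`c = true ↔` Charlie sees '1', `d = true ↔` Daniela sees '1'.  If the events
`{c ∧ d}`, `{a ∧ ¬d}` and `{¬c ∧ b}` all have probability `0`, then so does
`{a ∧ b}`; in particular no PMF makes those three events null while giving
`{a ∧ b}` probability `1/12`. -/
theorem no_joint_distribution_hardy :
    (∀ p : PMF (Bool × Bool × Bool × Bool),
      p.toMeasure {x | x.2.2.1 = true ∧ x.2.2.2 = true} = 0 →
      p.toMeasure {x | x.1 = true ∧ x.2.2.2 = false} = 0 →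
      p.toMeasure {x | x.2.2.1 = false ∧ x.2.1 = true} = 0 →
      p.toMeasure {x | x.1 = true ∧ x.2.1 = true} = 0) ∧
    ¬∃ p : PMF (Bool × Bool × Bool × Bool),
      p.toMeasure {x | x.2.2.1 = true ∧ x.2.2.2 = true} = 0 ∧
      p.toMeasure {x | x.1 = true ∧ x.2.2.2 = false} = 0 ∧
      p.toMeasure {x | x.2.2.1 = false ∧ x.2.1 = true} = 0 ∧
      p.toMeasure {x | x.1 = true ∧ x.2.1 = true} = 1 / 12 := by
  refine ⟨fun p => hardy_measure_eq_zero p.toMeasure, ?_⟩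
  rintro ⟨p, hcd, had, hcb, hab⟩
  rw [hardy_measure_eq_zero p.toMeasure hcd had hcb] at hab
  exact (ENNReal.div_pos one_ne_zero (ENNReal.ofNat_ne_top (n := 12))).ne hab
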